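/- For the boundary driven Kawasaki process on 𝒢_N with N odd, κ < 0, μ_L > 0, μ_R > 0, and min(μ_L, μ_R) < −κ: the alternating configuration (1,0,1,0,…,1,0,1) is the unique dominant state, i.e. Ψ((1,0,1,…,0,1)) > Ψ(y) for every other configuration y. -/

import Mathlib

open scoped Classical

namespace Kawasaki

/-- Configurations of the lattice gas on `{1,…,N}`: each site is occupied (`true`) or empty. -/
abbrev Config (N : ℕ) := Fin N → Bool

/-- Occupation number of site `i` as a real number. -/
noncomputable def occ {N : ℕ} (x : Config N) (i : Fin N) : ℝ := if x i then 1 else 0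

/-- The nearest-neighbour interaction energy `E(x) = -κ ∑ x(i) x(i+1)`. -/
noncomputable def energy {N : ℕ} (κ : ℝ) (x : Config N) : ℝ :=
  -κ * ∑ i : Fin N, ∑ j : Fin N, if (j : ℕ) = (i : ℕ) + 1 then occ x i * occ x j else 0

/-- `x^{i,j}`: the configuration with the occupations of `i` and `j` interchanged. -/
def swapConf {N : ℕ} (x : Config N) (i j : Fin N) : Config N :=
  Function.update (Function.update x i (x j)) j (x i)

/-- `x^i`: the configuration with the occupation at `i` flipped. -/
def flipConf {N : ℕ} (x : Config N) (i : Fin N) : Config N :=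
  Function.update x i (!x i)

/-- The last site. -/
def lastIdx (N : ℕ) [NeZero N] : Fin N :=
  ⟨N - 1, Nat.sub_lt (Nat.pos_of_ne_zero (NeZero.ne N)) Nat.one_pos⟩

/-- `y` is obtained from `x` by exchanging the occupations of two nearest neighbours. -/
def IsSwap {N : ℕ} (x y : Config N) : Prop :=
  ∃ i j : Fin N, (j : ℕ) = (i : ℕ) + 1 ∧ y = swapConf x i j

/-- The allowed transitions: nearest-neighbour exchanges in the bulk,
birth/death at the two boundary sites. -/
def Allowed {N : ℕ} [NeZero N] (x y : Config N) : Prop :=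
  y ≠ x ∧ (IsSwap x y ∨ y = flipConf x 0 ∨ y = flipConf x (lastIdx N))

/-- The transition rates of the boundary driven Kawasaki process at inverse temperature `β`. -/
noncomputable def rate {N : ℕ} [NeZero N] (κ μL μR β : ℝ) (x y : Config N) : ℝ :=
  if y = x then 0
  else if IsSwap x y then Real.exp (-(β / 2) * (energy κ y - energy κ x))
  else if y = flipConf x 0 then
    Real.exp (β * μL / 2 * (1 - 2 * occ x 0)) *
      Real.exp (-(β / 2) * (energy κ y - energy κ x))
  else if y = flipConf x (lastIdx N) then
    Real.exp (β * μR / 2 * (1 - 2 * occ x (lastIdx N))) *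
      Real.exp (-(β / 2) * (energy κ y - energy κ x))
  else 0

/-- `ρ` is a stationary probability distribution for the rates at inverse temperature `β`. -/
noncomputable def IsStationary {N : ℕ} [NeZero N] (κ μL μR β : ℝ) (ρ : Config N → ℝ) : Prop :=
  (∀ x, 0 ≤ ρ x) ∧ (∑ x, ρ x = 1) ∧
  ∀ x, ∑ y, ρ y * rate κ μL μR β y x = ρ x * ∑ y, rate κ μL μR β x y

/-- `φ(x,y) = lim_{β→∞} (1/β) log k(x→y;β)` (computed explicitly, the rates being
pure exponentials in `β`). -/
noncomputable def phi {N : ℕ} [NeZero N] (κ μL μR : ℝ) (x y : Config N) : ℝ :=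
  if IsSwap x y then -(energy κ y - energy κ x) / 2
  else if y = flipConf x 0 then
    μL * (1 - 2 * occ x 0) / 2 - (energy κ y - energy κ x) / 2
  else if y = flipConf x (lastIdx N) then
    μR * (1 - 2 * occ x (lastIdx N)) / 2 - (energy κ y - energy κ x) / 2
  else 0

/-- `Γ(x) = -max_y φ(x,y)` (maximum over the allowed transitions from `x`). -/
noncomputable def Gam {N : ℕ} [NeZero N] (κ μL μR : ℝ) (x : Config N) : ℝ :=
  - sSup (phi κ μL μR x '' {y | Allowed x y})

/-- `U(x,y) = -φ(x,y) - Γ(x)` (meaningful on allowed transitions). -/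
noncomputable def Ucost {N : ℕ} [NeZero N] (κ μL μR : ℝ) (x y : Config N) : ℝ :=
  - phi κ μL μR x y - Gam κ μL μR x

/-- The cost `U(D)` of a path: sum of `U` over consecutive steps. -/
noncomputable def pathCost {N : ℕ} [NeZero N] (κ μL μR : ℝ) : List (Config N) → ℝ
  | [] => 0
  | [_] => 0
  | a :: b :: l => Ucost κ μL μR a b + pathCost κ μL μR (b :: l)

/-- `𝒰(x,y)`: the minimal cost over all paths of allowed transitions from `x` to `y`. -/
noncomputable def Ucal {N : ℕ} [NeZero N] (κ μL μR : ℝ) (x y : Config N) : ℝ :=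
  sInf { c | ∃ L : List (Config N), L.Chain' Allowed ∧ L.head? = some x ∧
    L.getLast? = some y ∧ c = pathCost κ μL μR L }

/-- `t` encodes a spanning tree of the transition graph with all edges oriented toward `x`:
`t y` is the successor of `y` on the unique path from `y` to the root `x`. -/
def IsInTree {N : ℕ} [NeZero N] (t : Config N → Config N) (x : Config N) : Prop :=
  t x = x ∧ (∀ y, y ≠ x → Allowed y (t y)) ∧ ∀ y, ∃ n : ℕ, t^[n] y = x

/-- `U(𝒯_x)`: the sum of `U` over all (oriented) edges of the in-tree. -/
noncomputable def treeCost {N : ℕ} [NeZero N] (κ μL μR : ℝ) (t : Config N → Config N)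
    (x : Config N) : ℝ :=
  ∑ y : Config N, if y = x then 0 else Ucost κ μL μR y (t y)

/-- `Θ(x) = min_𝒯 U(𝒯_x)`. -/
noncomputable def Theta {N : ℕ} [NeZero N] (κ μL μR : ℝ) (x : Config N) : ℝ :=
  sInf { c | ∃ t, IsInTree t x ∧ c = treeCost κ μL μR t x }

/-- `Ψ = Γ - Θ`. -/
noncomputable def Psi {N : ℕ} [NeZero N] (κ μL μR : ℝ) (x : Config N) : ℝ :=
  Gam κ μL μR x - Theta κ μL μR x

/-- `η_{p,q}`: `p` occupied sites followed by `q = N - p` empty sites. -/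
def eta (N p : ℕ) : Config N := fun i => decide ((i : ℕ) < p)

/-- `x ∈ 𝒟` iff `x = η_{p,q}` with `p ≥ 3`, `q ≥ 2`, `p + q = N`. -/
def memD {N : ℕ} (x : Config N) : Prop :=
  ∃ p q : ℕ, 3 ≤ p ∧ 2 ≤ q ∧ p + q = N ∧ x = eta N p

/-- The configuration written in block form `(p_0,q_0,…,p_n,q_n)`:
`p_0` occupied sites, then `q_0` empty sites, and so on. -/
def blockConfig (ps qs : List ℕ) : List Bool :=
  (ps.zip qs).flatMap fun pq => List.replicate pq.1 true ++ List.replicate pq.2 false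

/-- `x ∈ 𝒫`: block form `(p_0,q_0,…,p_n,q_n)` with all `p_i ≥ 3`,
`q_i ≥ 3` for `i < n` and `q_n ≥ 2`. -/
def memP {N : ℕ} (x : Config N) : Prop :=
  ∃ ps qs : List ℕ, ps.length = qs.length ∧ 0 < ps.length ∧
    (∀ p ∈ ps, 3 ≤ p) ∧ (∀ q ∈ qs.dropLast, 3 ≤ q) ∧ (∀ q ∈ qs.getLast?, 2 ≤ q) ∧
    List.ofFn x = blockConfig ps qs

/-- `y` is obtained from `x` by one occupation switch of the form
`…11100… → …11010…` or `…00111… → …01011…`. -/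
def isSwitchE {N : ℕ} (x y : Config N) : Prop :=
  (∃ a : ℕ, ∃ h : a + 4 < N,
    x ⟨a, by omega⟩ = true ∧ x ⟨a + 1, by omega⟩ = true ∧ x ⟨a + 2, by omega⟩ = true ∧
    x ⟨a + 3, by omega⟩ = false ∧ x ⟨a + 4, by omega⟩ = false ∧
    y = swapConf x ⟨a + 2, by omega⟩ ⟨a + 3, by omega⟩) ∨
  (∃ a : ℕ, ∃ h : a + 4 < N,
    x ⟨a, by omega⟩ = false ∧ x ⟨a + 1, by omega⟩ = false ∧ x ⟨a + 2, by omega⟩ = true ∧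
    x ⟨a + 3, by omega⟩ = true ∧ x ⟨a + 4, by omega⟩ = true ∧
    y = swapConf x ⟨a + 1, by omega⟩ ⟨a + 2, by omega⟩)

/-- `y ∈ ℰ`: obtained from some `x ∈ 𝒫` by one such switch. -/
def memE {N : ℕ} (y : Config N) : Prop := ∃ x : Config N, memP x ∧ isSwitchE x y

/-- `y` is a preferred successor of `x`: an allowed transition with `U(x,y) = 0`. -/
def PreferredStep {N : ℕ} [NeZero N] (κ μL μR : ℝ) (x y : Config N) : Prop :=
  Allowed x y ∧ Ucost κ μL μR x y = 0

/-- `𝒜_x`: the set consisting of `x` together with all its preferred successors. -/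
def Attr {N : ℕ} [NeZero N] (κ μL μR : ℝ) (x : Config N) : Set (Config N) :=
  insert x {y | PreferredStep κ μL μR x y}

/-- A nonempty set `A` is an attractor when `𝒰 = 0` inside `A` and `𝒰 > 0` from `A`
to its complement. -/
def IsAttractor {N : ℕ} [NeZero N] (κ μL μR : ℝ) (A : Set (Config N)) : Prop :=
  A.Nonempty ∧ (∀ x ∈ A, ∀ y ∈ A, x ≠ y → Ucal κ μL μR x y = 0) ∧
  ∀ x ∈ A, ∀ y, y ∉ A → 0 < Ucal κ μL μR x y

/-- The weighted nearest-neighbour quadratic form `∑ w(i) g(i) g(i+1)`. -/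
noncomputable def pairForm {N : ℕ} (w g : Fin N → ℝ) : ℝ :=
  ∑ i : Fin N, ∑ j : Fin N, if (j : ℕ) = (i : ℕ) + 1 then w i * g i * g j else 0

/-- The contribution `w(p-1) g(p-1)` of the left neighbour, zero at the first site. -/
noncomputable def leftTerm {N : ℕ} (w g : Fin N → ℝ) (p : Fin N) : ℝ :=
  ∑ j : Fin N, if (p : ℕ) = (j : ℕ) + 1 then w j * g j else 0

/-- The value `g(p+1)` at the right neighbour, zero at the last site. -/
noncomputable def rightTerm {N : ℕ} (g : Fin N → ℝ) (p : Fin N) : ℝ :=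
  ∑ j : Fin N, if (j : ℕ) = (p : ℕ) + 1 then g j else 0

lemma leftTerm_eq {N : ℕ} (w g : Fin N → ℝ) {p i : Fin N} (h : (p : ℕ) = i + 1) :
    leftTerm w g p = w i * g i := by
  unfold leftTerm
  rw [Finset.sum_eq_single i]
  · simp [h]
  · intro j _ hj
    rw [if_neg]
    exact fun h' => hj (Fin.ext (by omega))
  · simp

lemma leftTerm_first {N : ℕ} (w g : Fin N → ℝ) {p : Fin N} (h : (p : ℕ) = 0) :
    leftTerm w g p = 0 :=
  Finset.sum_eq_zero fun j _ => if_neg (by omega)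

lemma rightTerm_eq {N : ℕ} (g : Fin N → ℝ) {p j : Fin N} (h : (j : ℕ) = p + 1) :
    rightTerm g p = g j := by
  unfold rightTerm
  rw [Finset.sum_eq_single j]
  · simp [h]
  · intro k _ hk
    rw [if_neg]
    exact fun h' => hk (Fin.ext (by omega))
  · simp

lemma rightTerm_last {N : ℕ} (g : Fin N → ℝ) {p : Fin N} (h : (p : ℕ) + 1 = N) :
    rightTerm g p = 0 :=
  Finset.sum_eq_zero fun j _ => if_neg (by omega)

lemma pairForm_update {N : ℕ} (w g : Fin N → ℝ) (p : Fin N) (b : ℝ) :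
    pairForm w (Function.update g p b) =
      pairForm w g + (b - g p) * (leftTerm w g p + w p * rightTerm g p) := by
  have key : ∀ i j : Fin N,
      (if (j : ℕ) = (i : ℕ) + 1 then
        w i * Function.update g p b i * Function.update g p b j else 0) =
      (if (j : ℕ) = (i : ℕ) + 1 then w i * g i * g j else 0) +
      (if j = p then (if (p : ℕ) = (i : ℕ) + 1 then (b - g p) * (w i * g i) else 0) else 0) +
      (if i = p then (if (j : ℕ) = (p : ℕ) + 1 then (b - g p) * w p * g j else 0) else 0) := by
    intro i j
    by_cases hi : i = p <;> by_cases hj : j = p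
    · subst hi; subst hj; simp
    · subst hi
      simp only [hj, Function.update_self, ne_eq, not_false_eq_true, Function.update_of_ne,
        if_true, if_false]
      split_ifs <;> ring
    · subst hj
      simp only [hi, Function.update_self, ne_eq, not_false_eq_true, Function.update_of_ne,
        if_true, if_false]
      split_ifs <;> ring
    · simp [hi, hj]
  unfold pairForm leftTerm rightTerm
  simp only [key, Finset.sum_add_distrib, Finset.sum_ite_eq', Finset.mem_univ, if_true]
  have h3 : (∑ i : Fin N, ∑ j : Fin N,
      if i = p then (if (j : ℕ) = (p : ℕ) + 1 then (b - g p) * w p * g j else 0) else 0) =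
      ∑ j : Fin N, if (j : ℕ) = (p : ℕ) + 1 then (b - g p) * w p * g j else 0 := by
    rw [Finset.sum_comm]
    simp
  rw [h3, mul_add, ← mul_assoc, Finset.mul_sum, Finset.mul_sum]
  simp only [mul_ite, mul_zero]
  ring

lemma leftTerm_update {N : ℕ} (w g : Fin N → ℝ) {p q : Fin N} (h : (q : ℕ) = p + 1) (b : ℝ) :
    leftTerm w (Function.update g p b) q = w p * b := by
  rw [leftTerm_eq _ _ h, Function.update_self]

lemma rightTerm_update {N : ℕ} (g : Fin N → ℝ) {p q : Fin N} (h : (q : ℕ) = p + 1) (b : ℝ) :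
    rightTerm (Function.update g p b) q = rightTerm g q := by
  refine Finset.sum_congr rfl fun j _ => ?_
  split_ifs with hj
  · rw [Function.update_of_ne]
    rintro rfl
    omega
  · rfl

lemma pairForm_swap {N : ℕ} (w g : Fin N → ℝ) {p q : Fin N} (h : (q : ℕ) = p + 1) :
    pairForm w (Function.update (Function.update g p (g q)) q (g p)) =
      pairForm w g + (g q - g p) * (leftTerm w g p - w q * rightTerm g q) := by
  have hqp : q ≠ p := by rintro rfl; omega
  rw [pairForm_update, pairForm_update, leftTerm_update w g h, rightTerm_update g h,
    rightTerm_eq g h, Function.update_of_ne hqp]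
  ring

lemma occ_update {N : ℕ} (x : Config N) (i : Fin N) (b : Bool) :
    occ (Function.update x i b) = Function.update (occ x) i (if b then 1 else 0) := by
  funext k
  by_cases hk : k = i
  · subst hk; simp [occ]
  · simp [occ, hk]

lemma occ_flipConf {N : ℕ} (x : Config N) (i : Fin N) :
    occ (flipConf x i) = Function.update (occ x) i (1 - occ x i) := by
  rw [flipConf, occ_update]
  cases h : x i <;> simp [occ, h]

lemma occ_swapConf {N : ℕ} (x : Config N) (i j : Fin N) :
    occ (swapConf x i j) = Function.update (Function.update (occ x) i (occ x j)) j (occ x i) := by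
  rw [swapConf, occ_update, occ_update]
  rfl

lemma occ_of_true {N : ℕ} {x : Config N} {i : Fin N} (h : x i = true) : occ x i = 1 := by
  simp [occ, h]

lemma occ_of_false {N : ℕ} {x : Config N} {i : Fin N} (h : x i = false) : occ x i = 0 := by
  simp [occ, h]

lemma occ_eq_zero_or_one {N : ℕ} (x : Config N) (i : Fin N) : occ x i = 0 ∨ occ x i = 1 := by
  cases h : x i <;> simp [occ, h]

lemma leftTerm_occ {N : ℕ} (x : Config N) (p : Fin N) :
    leftTerm (fun _ => 1) (occ x) p = 0 ∨ leftTerm (fun _ => 1) (occ x) p = 1 := by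
  by_cases h : (p : ℕ) = 0
  · exact Or.inl (leftTerm_first _ _ h)
  · rw [leftTerm_eq (i := ⟨p - 1, by omega⟩) _ _ (by simp; omega), one_mul]
    exact occ_eq_zero_or_one _ _

lemma rightTerm_occ {N : ℕ} (x : Config N) (p : Fin N) :
    rightTerm (occ x) p = 0 ∨ rightTerm (occ x) p = 1 := by
  by_cases h : (p : ℕ) + 1 = N
  · exact Or.inl (rightTerm_last _ h)
  · rw [rightTerm_eq (j := ⟨p + 1, by omega⟩) _ rfl]
    exact occ_eq_zero_or_one _ _

lemma energy_eq_pairForm {N : ℕ} (κ : ℝ) (x : Config N) :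
    energy κ x = -κ * pairForm (fun _ => 1) (occ x) := by
  simp only [energy, pairForm, one_mul]

lemma energy_swapConf {N : ℕ} (κ : ℝ) (x : Config N) {p q : Fin N} (h : (q : ℕ) = p + 1) :
    energy κ (swapConf x p q) = energy κ x +
      -κ * ((occ x q - occ x p) * (leftTerm (fun _ => 1) (occ x) p - rightTerm (occ x) q)) := by
  rw [energy_eq_pairForm, energy_eq_pairForm, occ_swapConf, pairForm_swap _ _ h]
  ring

lemma energy_flip_first {N : ℕ} [NeZero N] (κ : ℝ) (x : Config N) :
    energy κ (flipConf x 0) =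
      energy κ x + -κ * ((1 - 2 * occ x 0) * rightTerm (occ x) 0) := by
  rw [energy_eq_pairForm, energy_eq_pairForm, occ_flipConf, pairForm_update,
    leftTerm_first _ _ (by simp)]
  ring

lemma lastIdx_add_one (N : ℕ) [NeZero N] : (lastIdx N : ℕ) + 1 = N := by
  have := Nat.pos_of_ne_zero (NeZero.ne N)
  simp only [lastIdx]
  omega

lemma energy_flip_last {N : ℕ} [NeZero N] (κ : ℝ) (x : Config N) :
    energy κ (flipConf x (lastIdx N)) = energy κ x +
      -κ * ((1 - 2 * occ x (lastIdx N)) * leftTerm (fun _ => 1) (occ x) (lastIdx N)) := by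
  rw [energy_eq_pairForm, energy_eq_pairForm, occ_flipConf, pairForm_update,
    rightTerm_last _ (lastIdx_add_one N)]
  ring

/-- The number of particles. -/
noncomputable def mass {N : ℕ} (x : Config N) : ℝ := ∑ i, occ x i

lemma mass_flipConf {N : ℕ} (x : Config N) (i : Fin N) :
    mass (flipConf x i) = mass x + (1 - 2 * occ x i) := by
  rw [mass, occ_flipConf, Finset.sum_update_of_mem (Finset.mem_univ i), mass,
    ← Finset.add_sum_erase _ _ (Finset.mem_univ i), Finset.sdiff_singleton_eq_erase]
  ring

lemma swapConf_eq_comp {N : ℕ} (x : Config N) (i j : Fin N) :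
    swapConf x i j = x ∘ Equiv.swap i j := by
  funext k
  by_cases hj : k = j
  · subst hj; simp [swapConf]
  · by_cases hi : k = i
    · subst hi; simp [swapConf, hj]
    · simp [swapConf, hi, hj, Equiv.swap_apply_of_ne_of_ne]

lemma mass_swapConf {N : ℕ} (x : Config N) (i j : Fin N) : mass (swapConf x i j) = mass x := by
  rw [mass, swapConf_eq_comp]
  exact Equiv.sum_comp (Equiv.swap i j) (occ x)

lemma not_isSwap_flipConf {N : ℕ} (x : Config N) (i : Fin N) : ¬ IsSwap x (flipConf x i) := by
  rintro ⟨p, q, -, h⟩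
  have h1 := mass_flipConf x i
  rw [h, mass_swapConf] at h1
  rcases occ_eq_zero_or_one x i with h2 | h2 <;> rw [h2] at h1 <;> linarith

lemma phi_swapConf {N : ℕ} [NeZero N] (κ μL μR : ℝ) (x : Config N) {p q : Fin N}
    (h : (q : ℕ) = p + 1) : phi κ μL μR x (swapConf x p q) =
      -(energy κ (swapConf x p q) - energy κ x) / 2 :=
  if_pos ⟨p, q, h, rfl⟩

lemma flipConf_ne {N : ℕ} (x : Config N) (i : Fin N) : flipConf x i ≠ x := by
  intro h
  have := congrFun h i
  simp [flipConf] at this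

lemma phi_flip_first {N : ℕ} [NeZero N] (κ μL μR : ℝ) (x : Config N) :
    phi κ μL μR x (flipConf x 0) =
      (1 - 2 * occ x 0) * (μL + κ * rightTerm (occ x) 0) / 2 := by
  rw [phi, if_neg (not_isSwap_flipConf x 0), if_pos rfl, energy_flip_first]
  ring

lemma flip_first_ne_flip_last {N : ℕ} [NeZero N] (hN : 2 ≤ N) (x : Config N) :
    flipConf x 0 ≠ flipConf x (lastIdx N) := by
  intro h
  have h0 : (0 : Fin N) ≠ lastIdx N := by
    intro h'
    have h1 := lastIdx_add_one N
    rw [← h'] at h1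
    simp at h1
    omega
  have := congrFun h 0
  simp [flipConf, h0] at this

lemma phi_flip_last {N : ℕ} [NeZero N] (hN : 2 ≤ N) (κ μL μR : ℝ) (x : Config N) :
    phi κ μL μR x (flipConf x (lastIdx N)) = (1 - 2 * occ x (lastIdx N)) *
      (μR + κ * leftTerm (fun _ => 1) (occ x) (lastIdx N)) / 2 := by
  rw [phi, if_neg (not_isSwap_flipConf x _), if_neg (flip_first_ne_flip_last hN x).symm,
    if_pos rfl, energy_flip_last]
  ring

/-- The alternating configuration `(1,0,1,…)`. -/
def alternating (N : ℕ) : Config N := fun i => decide ((i : ℕ) % 2 = 0)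

/-- The spin variable `2x(i) - 1`. -/
noncomputable def spin {N : ℕ} (x : Config N) (i : Fin N) : ℝ := 2 * occ x i - 1

/-- A weighted count of equal neighbours which decreases as they move to the right. -/
noncomputable def alignment {N : ℕ} (x : Config N) : ℝ :=
  pairForm (fun i => (N : ℝ) - (i : ℕ)) (spin x)

/-- The energy with a chemical potential that favours creation only at sites
without an occupied neighbour. -/
noncomputable def grandEnergy {N : ℕ} (κ : ℝ) (x : Config N) : ℝ :=
  energy κ x + κ / 2 * mass x

lemma spin_swapConf {N : ℕ} (x : Config N) (i j : Fin N) :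
    spin (swapConf x i j) =
      Function.update (Function.update (spin x) i (spin x j)) j (spin x i) := by
  funext k
  unfold spin
  rw [occ_swapConf]
  by_cases hj : k = j
  · subst hj; simp
  · by_cases hi : k = i
    · subst hi; simp [hj]
    · simp [hi, hj]

lemma alignment_swapConf {N : ℕ} (x : Config N) {p q : Fin N} (h : (q : ℕ) = p + 1) :
    alignment (swapConf x p q) = alignment x + (spin x q - spin x p) *
      (leftTerm (fun i => (N : ℝ) - (i : ℕ)) (spin x) p -
        ((N : ℝ) - (q : ℕ)) * rightTerm (spin x) q) := by
  rw [alignment, alignment, spin_swapConf, pairForm_swap _ _ h]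

lemma grandEnergy_flip_lt {κ μ o n d : ℝ} (hμ : 0 < μ) (hμκ : μ < -κ)
    (ho : o = 0 ∨ o = 1) (hn : n = 0 ∨ n = 1) (h : 0 < (1 - 2 * o) * (μ + κ * n) / 2)
    (hd : d = -κ * ((1 - 2 * o) * n) + κ / 2 * (1 - 2 * o)) : d < 0 := by
  rcases ho with rfl | rfl <;> rcases hn with rfl | rfl <;> norm_num at h hd <;> linarith

lemma Allowed.grandEnergy_lt_or {N : ℕ} [NeZero N] (hN : 2 ≤ N) {κ μL μR : ℝ}
    (hμL : 0 < μL) (hμR : 0 < μR) (hR : μR < -κ) {x y : Config N} (h : Allowed x y)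
    (hφ : 0 < phi κ μL μR x y) :
    (grandEnergy κ y < grandEnergy κ x ∧ (μL < -κ ∨ occ x 0 ≤ occ y 0)) ∨
      (-κ ≤ μL ∧ occ x 0 < occ y 0) := by
  obtain ⟨-, ⟨p, q, hpq, rfl⟩ | rfl | rfl⟩ := h
  · rw [phi_swapConf _ _ _ _ hpq] at hφ
    refine Or.inl ⟨?_, Or.inr ?_⟩
    · unfold grandEnergy
      rw [mass_swapConf]
      linarith
    · by_cases hp : (p : ℕ) = 0
      · obtain rfl : p = 0 := Fin.ext (by simpa using hp)
        rw [energy_swapConf _ _ hpq, leftTerm_first _ _ hp] at hφ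
        have h0 : occ (swapConf x 0 q) 0 = occ x q := by
          have : (0 : Fin N) ≠ q := by rintro rfl; omega
          rw [occ_swapConf, Function.update_of_ne this, Function.update_self]
        rw [h0]
        rcases occ_eq_zero_or_one x 0 with ha | ha <;>
        rcases occ_eq_zero_or_one x q with hb | hb <;>
        rcases rightTerm_occ x q with hc | hc <;>
        rw [ha, hb, hc] at hφ <;> rw [ha, hb] <;> linarith
      · have hp0 : (0 : Fin N) ≠ p := by rintro rfl; simp at hp
        have hq0 : (0 : Fin N) ≠ q := by rintro rfl; simp at hpq
        rw [occ_swapConf, Function.update_of_ne hq0, Function.update_of_ne hp0]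
  · rw [phi_flip_first] at hφ
    by_cases hL : μL < -κ
    · refine Or.inl ⟨?_, Or.inl hL⟩
      have := grandEnergy_flip_lt hμL hL (occ_eq_zero_or_one x 0) (rightTerm_occ x 0) hφ
        (d := grandEnergy κ (flipConf x 0) - grandEnergy κ x)
        (by unfold grandEnergy; rw [mass_flipConf, energy_flip_first]; ring)
      linarith
    · refine Or.inr ⟨not_lt.1 hL, ?_⟩
      rw [occ_flipConf, Function.update_self]
      rcases occ_eq_zero_or_one x 0 with ha | ha <;>
      rcases rightTerm_occ x 0 with hc | hc <;>
      rw [ha, hc] at hφ <;> rw [ha] <;> linarith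
  · rw [phi_flip_last hN] at hφ
    refine Or.inl ⟨?_, Or.inr ?_⟩
    · have := grandEnergy_flip_lt hμR hR (occ_eq_zero_or_one x _) (leftTerm_occ x _) hφ
        (d := grandEnergy κ (flipConf x (lastIdx N)) - grandEnergy κ x)
        (by unfold grandEnergy; rw [mass_flipConf, energy_flip_last]; ring)
      linarith
    · have h0 : (0 : Fin N) ≠ lastIdx N := by
        intro h'
        have h1 := lastIdx_add_one N
        rw [← h'] at h1
        simp at h1
        omega
      rw [occ_flipConf, Function.update_of_ne h0]

/-- Neighbouring sites `i`, `i + 1` carry the same occupation. -/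
def EqualPair {N : ℕ} (x : Config N) (i : ℕ) : Prop :=
  ∃ h : i + 1 < N, x ⟨i, by omega⟩ = x ⟨i + 1, h⟩

lemma alternating_of_no_equalPair {N : ℕ} [NeZero N] {x : Config N} (h0 : x 0 = true)
    (h : ∀ i, ¬ EqualPair x i) : x = alternating N := by
  have key : ∀ k (hk : k < N), x ⟨k, hk⟩ = decide (k % 2 = 0) := by
    intro k
    induction k with
    | zero => intro hk; simpa using h0
    | succ k ih =>
      intro hk
      have h1 : ¬ x ⟨k, by omega⟩ = x ⟨k + 1, hk⟩ := fun h' => h k ⟨hk, h'⟩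
      rw [ih (by omega)] at h1
      rcases Nat.mod_two_eq_zero_or_one k with hm | hm
      · have : (k + 1) % 2 = 1 := by omega
        simp_all
      · have : (k + 1) % 2 = 0 := by omega
        simp_all
  funext i
  exact key i i.2

lemma exists_last_equalPair {N : ℕ} {x : Config N} (h : ∃ i, EqualPair x i) :
    ∃ i, EqualPair x i ∧ ∀ k, i < k → ¬ EqualPair x k := by
  obtain ⟨i, hi⟩ := h
  have hb : ∀ k, EqualPair x k → k ≤ N := fun k hk => by
    obtain ⟨hk, -⟩ := hk
    omega
  refine ⟨Nat.findGreatest (EqualPair x) N, Nat.findGreatest_spec (hb i hi) hi, ?_⟩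
  intro k hk hP
  exact Nat.findGreatest_is_greatest hk (hb k hP) hP

/-- Off the alternating configuration there is a transition of nonnegative exponent, and it makes
progress if its exponent vanishes. -/
lemma exists_allowed_phi_nonneg {N : ℕ} [NeZero N] (hN : 2 ≤ N) {κ μL μR : ℝ}
    (hμR : 0 < μR) (hR : μR < -κ) {x : Config N} (hx : x ≠ alternating N) :
    ∃ y, Allowed x y ∧ 0 ≤ phi κ μL μR x y ∧ (phi κ μL μR x y = 0 →
      grandEnergy κ y = grandEnergy κ x ∧
        (occ x 0 < occ y 0 ∨ occ y 0 = occ x 0 ∧ alignment y < alignment x)) := by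
  by_cases hex : ∃ i, EqualPair x i
  · obtain ⟨i, ⟨hi, hxi⟩, hmax⟩ := exists_last_equalPair hex
    by_cases hlast : i + 2 = N
    · have hl : (lastIdx N : ℕ) = i + 1 := by have := lastIdx_add_one N; omega
      have hL : lastIdx N = ⟨i + 1, hi⟩ := Fin.ext hl
      have hpos : 0 < phi κ μL μR x (flipConf x (lastIdx N)) := by
        rw [phi_flip_last hN, leftTerm_eq (i := ⟨i, by omega⟩) _ _ hl, hL]
        cases hb : x ⟨i + 1, hi⟩ <;> rw [hb] at hxi
        · rw [occ_of_false hb, occ_of_false hxi]; linarith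
        · rw [occ_of_true hb, occ_of_true hxi]; linarith
      exact ⟨_, ⟨flipConf_ne _ _, Or.inr (Or.inr rfl)⟩, hpos.le, fun h => absurd h hpos.ne'⟩
    · have hi2 : i + 2 < N := by omega
      set l : Fin N := ⟨i, by omega⟩ with hl
      set p : Fin N := ⟨i + 1, hi⟩ with hp
      set q : Fin N := ⟨i + 2, hi2⟩ with hq
      have hpq : (q : ℕ) = p + 1 := rfl
      have hlp : (p : ℕ) = l + 1 := rfl
      have hne : x p ≠ x q := fun h => hmax (i + 1) (by omega) ⟨hi2, h⟩
      have hol : occ x l = occ x p := by unfold occ; rw [hxi]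
      have hpq1 : occ x q = 1 - occ x p := by
        cases hb : x p <;> cases hc : x q <;> simp_all [occ]
      have hp0 : (0 : Fin N) ≠ p := by intro h; rw [← h] at hlp; simp at hlp
      have hq0 : (0 : Fin N) ≠ q := by intro h; rw [← h] at hpq; simp at hpq
      have hocc0 : occ (swapConf x p q) 0 = occ x 0 := by
        rw [occ_swapConf, Function.update_of_ne hq0, Function.update_of_ne hp0]
      have hr : (rightTerm (occ x) q = occ x p ∧ rightTerm (spin x) q = spin x p) ∨
          (rightTerm (occ x) q = 0 ∧ rightTerm (spin x) q = 0) := by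
        by_cases hlast' : i + 3 = N
        · exact Or.inr ⟨rightTerm_last _ hlast', rightTerm_last _ hlast'⟩
        · left
          have hi3 : i + 3 < N := by omega
          have hne' : x q ≠ x ⟨i + 3, hi3⟩ := fun h => hmax (i + 2) (by omega) ⟨hi3, h⟩
          have hor : occ x ⟨i + 3, hi3⟩ = occ x p := by
            cases hb : x p <;> cases hc : x q <;> cases hd : x ⟨i + 3, hi3⟩ <;> simp_all [occ]
          rw [rightTerm_eq (j := ⟨i + 3, hi3⟩) _ rfl, rightTerm_eq (j := ⟨i + 3, hi3⟩) _ rfl]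
          exact ⟨hor, by rw [spin, spin, hor]⟩
      refine ⟨swapConf x p q, ⟨?_, Or.inl ⟨p, q, hpq, rfl⟩⟩, ?_, ?_⟩
      · intro h
        have := congrFun h q
        simp only [swapConf, Function.update_self] at this
        exact hne this
      · rw [phi_swapConf _ _ _ _ hpq, energy_swapConf _ _ hpq, leftTerm_eq _ _ hlp, hol, hpq1]
        rcases occ_eq_zero_or_one x p with ha | ha <;> rcases hr with ⟨hr, -⟩ | ⟨hr, -⟩ <;>
          rw [hr, ha] <;> linarith
      · intro hφ
        rw [phi_swapConf _ _ _ _ hpq] at hφ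
        refine ⟨?_, Or.inr ⟨hocc0, ?_⟩⟩
        · unfold grandEnergy
          rw [mass_swapConf]
          linarith
        · rw [alignment_swapConf _ hpq, leftTerm_eq _ _ hlp]
          have hNr : (i : ℝ) + 2 < N := by exact_mod_cast hi2
          have e1 : ((l : ℕ) : ℝ) = i := rfl
          have e2 : ((q : ℕ) : ℝ) = i + 2 := by simp [hq]
          rw [e1, e2]
          rcases hr with ⟨-, hr⟩ | ⟨-, hr⟩ <;> rw [hr] <;> unfold spin <;> rw [hol, hpq1] <;>
          rcases occ_eq_zero_or_one x p with ha | ha <;> rw [ha] <;> linarith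
  · push Not at hex
    have h0 : x 0 = false := by
      by_contra h
      exact hx (alternating_of_no_equalPair (by simpa using h) hex)
    set q : Fin N := ⟨1, by omega⟩ with hq
    have hpq : (q : ℕ) = (0 : Fin N) + 1 := by simp [hq]
    have h1 : x q = true := by
      by_contra h
      refine hex 0 ⟨by omega, ?_⟩
      have e : (⟨0, by omega⟩ : Fin N) = 0 := rfl
      rw [e, h0]
      simpa using (Bool.eq_false_of_not_eq_true h).symm
    have hr : rightTerm (occ x) q = 0 := by
      by_cases hlast : 2 = N
      · exact rightTerm_last _ hlast
      · have h2 : 2 < N := by omega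
        have hne : x q ≠ x ⟨2, h2⟩ := fun h => hex 1 ⟨h2, h⟩
        rw [rightTerm_eq (j := ⟨2, h2⟩) _ rfl]
        refine occ_of_false ?_
        rw [h1] at hne
        simpa using hne.symm
    have hE : energy κ (swapConf x 0 q) = energy κ x := by
      rw [energy_swapConf _ _ hpq, leftTerm_first _ _ (by simp), hr]
      ring
    have hq0 : (0 : Fin N) ≠ q := by intro h; rw [← h] at hpq; simp at hpq
    refine ⟨swapConf x 0 q, ⟨?_, Or.inl ⟨0, q, hpq, rfl⟩⟩, ?_, fun _ => ⟨?_, Or.inl ?_⟩⟩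
    · intro h
      have := congrFun h q
      simp [swapConf, h0, h1] at this
    · rw [phi_swapConf _ _ _ _ hpq, hE]
      simp
    · rw [grandEnergy, grandEnergy, hE, mass_swapConf]
    · rw [occ_swapConf, Function.update_of_ne hq0, Function.update_self, occ_of_false h0,
        occ_of_true h1]
      norm_num

lemma exists_allowed {N : ℕ} [NeZero N] (x : Config N) : ∃ y, Allowed x y :=
  ⟨flipConf x 0, flipConf_ne x 0, Or.inr (Or.inl rfl)⟩

lemma exists_max_phi {N : ℕ} [NeZero N] (κ μL μR : ℝ) (x : Config N) :
    ∃ y, Allowed x y ∧ ∀ z, Allowed x z → phi κ μL μR x z ≤ phi κ μL μR x y :=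
  Set.exists_max_image {y | Allowed x y} (phi κ μL μR x) (Set.toFinite _) (exists_allowed x)

/-- Some function on configurations can be lowered from every configuration other than the
alternating one by a transition of maximal exponent, and that exponent is nonnegative. -/
def HasDescent (N : ℕ) [NeZero N] (κ μL μR : ℝ) : Prop :=
  ∃ V : Config N → ℝ ×ₗ (ℝ ×ₗ ℝ), ∀ x, x ≠ alternating N → ∃ y, Allowed x y ∧
    0 ≤ phi κ μL μR x y ∧ (∀ z, Allowed x z → phi κ μL μR x z ≤ phi κ μL μR x y) ∧ V y < V x

lemma hasDescent_of_right_lt {N : ℕ} [NeZero N] (hN : 2 ≤ N) {κ μL μR : ℝ}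
    (hμL : 0 < μL) (hμR : 0 < μR) (hR : μR < -κ) : HasDescent N κ μL μR := by
  have step : ∀ x, x ≠ alternating N → ∃ y, Allowed x y ∧ 0 ≤ phi κ μL μR x y ∧
      (∀ z, Allowed x z → phi κ μL μR x z ≤ phi κ μL μR x y) ∧
      (((grandEnergy κ y < grandEnergy κ x ∧ (μL < -κ ∨ occ x 0 ≤ occ y 0)) ∨
        (-κ ≤ μL ∧ occ x 0 < occ y 0)) ∨
      (grandEnergy κ y = grandEnergy κ x ∧
        (occ x 0 < occ y 0 ∨ occ y 0 = occ x 0 ∧ alignment y < alignment x))) := by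
    intro x hx
    obtain ⟨y, hy, hmax⟩ := exists_max_phi κ μL μR x
    obtain ⟨z, hz, hz0, hzp⟩ := exists_allowed_phi_nonneg hN (μL := μL) hμR hR hx
    by_cases hpos : 0 < phi κ μL μR x y
    · exact ⟨y, hy, hpos.le, hmax, Or.inl (hy.grandEnergy_lt_or hN hμL hμR hR hpos)⟩
    · have hzy := hmax z hz
      exact ⟨z, hz, hz0, fun w hw => by linarith [hmax w hw], Or.inr (hzp (by linarith))⟩
  by_cases hL : μL < -κ
  · refine ⟨fun x => toLex (grandEnergy κ x, toLex (-occ x 0, alignment x)), fun x hx => ?_⟩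
    obtain ⟨y, h1, h2, h3, h4⟩ := step x hx
    refine ⟨y, h1, h2, h3, ?_⟩
    simp only [Prod.Lex.toLex_lt_toLex]
    rcases h4 with (⟨h, -⟩ | ⟨h, -⟩) | ⟨h, h' | ⟨h', h''⟩⟩
    · exact Or.inl h
    · linarith
    · exact Or.inr ⟨h, Or.inl (by linarith)⟩
    · exact Or.inr ⟨h, Or.inr ⟨by rw [h'], h''⟩⟩
  · refine ⟨fun x => toLex (-occ x 0, toLex (grandEnergy κ x, alignment x)), fun x hx => ?_⟩
    obtain ⟨y, h1, h2, h3, h4⟩ := step x hx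
    refine ⟨y, h1, h2, h3, ?_⟩
    simp only [Prod.Lex.toLex_lt_toLex]
    rcases h4 with (⟨h, h' | h'⟩ | ⟨-, h⟩) | ⟨h, h' | ⟨h', h''⟩⟩
    · exact absurd h' hL
    · rcases h'.lt_or_eq with h'' | h''
      · exact Or.inl (by linarith)
      · exact Or.inr ⟨by rw [h''], Or.inl h⟩
    · exact Or.inl (by linarith)
    · exact Or.inl (by linarith)
    · exact Or.inr ⟨by rw [h'], Or.inr ⟨h, h''⟩⟩

/-- The mirror image of a configuration. -/
def mirror {N : ℕ} (x : Config N) : Config N := fun i => x i.rev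

lemma mirror_mirror {N : ℕ} (x : Config N) : mirror (mirror x) = x := by
  funext i
  simp [mirror]

lemma mirror_alternating {N : ℕ} (hN : Odd N) : mirror (alternating N) = alternating N := by
  funext i
  obtain ⟨m, hm⟩ := hN
  simp only [mirror, alternating, Fin.val_rev]
  congr 1
  apply propext
  have := i.2
  omega

lemma occ_mirror {N : ℕ} (x : Config N) (i : Fin N) : occ (mirror x) i = occ x i.rev := rfl

lemma energy_mirror {N : ℕ} (κ : ℝ) (x : Config N) : energy κ (mirror x) = energy κ x := by
  unfold energy
  congr 1
  rw [← Equiv.sum_comp Fin.revPerm, Finset.sum_comm, ← Equiv.sum_comp Fin.revPerm]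
  refine Finset.sum_congr rfl fun i _ => Finset.sum_congr rfl fun j _ => ?_
  simp only [occ_mirror, Fin.revPerm_apply, Fin.rev_rev, Fin.val_rev]
  have := i.2
  have := j.2
  by_cases h : (j : ℕ) = i + 1
  · rw [if_pos h, if_pos (by omega), mul_comm]
  · rw [if_neg h, if_neg (by omega)]

lemma mirror_flipConf {N : ℕ} (x : Config N) (i : Fin N) :
    mirror (flipConf x i) = flipConf (mirror x) i.rev := by
  funext k
  by_cases h : k = i.rev
  · subst h; simp [mirror, flipConf]
  · have : k.rev ≠ i := by rintro rfl; simp at h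
    simp [mirror, flipConf, h, this]

lemma mirror_swapConf {N : ℕ} (x : Config N) (i j : Fin N) (h : i ≠ j) :
    mirror (swapConf x i j) = swapConf (mirror x) j.rev i.rev := by
  funext k
  by_cases hi : k = i.rev
  · subst hi; simp [mirror, swapConf, h]
  · by_cases hj : k = j.rev
    · subst hj; simp [mirror, swapConf, hi]
    · have h1 : k.rev ≠ i := by rintro rfl; simp at hi
      have h2 : k.rev ≠ j := by rintro rfl; simp at hj
      simp [mirror, swapConf, hi, hj, h1, h2]

lemma rev_first (N : ℕ) [NeZero N] : (0 : Fin N).rev = lastIdx N := by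
  ext
  simp [lastIdx]

lemma rev_last (N : ℕ) [NeZero N] : (lastIdx N).rev = 0 := by
  rw [← rev_first, Fin.rev_rev]

lemma IsSwap.mirror {N : ℕ} {x y : Config N} (h : IsSwap x y) :
    IsSwap (mirror x) (mirror y) := by
  obtain ⟨i, j, hij, rfl⟩ := h
  refine ⟨j.rev, i.rev, ?_, mirror_swapConf x i j (by rintro rfl; omega)⟩
  have := j.2
  simp only [Fin.val_rev]
  omega

lemma Allowed.mirror {N : ℕ} [NeZero N] {x y : Config N} (h : Allowed x y) :
    Allowed (mirror x) (mirror y) := by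
  obtain ⟨hne, h⟩ := h
  refine ⟨fun h' => hne ?_, ?_⟩
  · rw [← mirror_mirror y, h', mirror_mirror]
  · rcases h with h | rfl | rfl
    · exact Or.inl h.mirror
    · exact Or.inr (Or.inr (by rw [mirror_flipConf, rev_first]))
    · exact Or.inr (Or.inl (by rw [mirror_flipConf, rev_last]))

lemma Allowed.phi_mirror {N : ℕ} [NeZero N] (hN : 2 ≤ N) (κ μL μR : ℝ) {x y : Config N}
    (h : Allowed x y) : phi κ μL μR (Kawasaki.mirror x) (Kawasaki.mirror y) = phi κ μR μL x y := by
  by_cases hs : IsSwap x y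
  · rw [phi, phi, if_pos hs, if_pos hs.mirror, energy_mirror, energy_mirror]
  · have hs' : ¬ IsSwap (Kawasaki.mirror x) (Kawasaki.mirror y) := fun h' => hs (by
      simpa only [mirror_mirror] using h'.mirror)
    rw [phi, phi, if_neg hs, if_neg hs', energy_mirror, energy_mirror, occ_mirror, occ_mirror,
      rev_first, rev_last]
    rcases h.2 with h | rfl | rfl
    · exact absurd h hs
    · rw [mirror_flipConf, rev_first, if_neg (flip_first_ne_flip_last hN _).symm, if_pos rfl,
        if_pos rfl]
    · rw [mirror_flipConf, rev_last, if_pos rfl, if_neg (flip_first_ne_flip_last hN _).symm,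
        if_pos rfl]

lemma HasDescent.mirror {N : ℕ} [NeZero N] (hN : 2 ≤ N) (hodd : Odd N) {κ μL μR : ℝ}
    (h : HasDescent N κ μL μR) : HasDescent N κ μR μL := by
  obtain ⟨V, hV⟩ := h
  refine ⟨fun x => V (Kawasaki.mirror x), fun x hx => ?_⟩
  have hx' : Kawasaki.mirror x ≠ alternating N := fun h' => hx (by
    rw [← mirror_mirror x, h', mirror_alternating hodd])
  obtain ⟨y, h1, h2, h3, h4⟩ := hV _ hx'
  have hy : Allowed x (Kawasaki.mirror y) := by simpa only [mirror_mirror] using h1.mirror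
  have hφ : phi κ μR μL x (Kawasaki.mirror y) = phi κ μL μR (Kawasaki.mirror x) y := by
    rw [← hy.phi_mirror hN, mirror_mirror]
  refine ⟨Kawasaki.mirror y, hy, hφ ▸ h2, fun z hz => ?_, by simpa only [mirror_mirror] using h4⟩
  rw [hφ, ← hz.phi_mirror hN]
  exact h3 _ hz.mirror

lemma hasDescent_one {κ μL μR : ℝ} [NeZero 1] (hμL : 0 < μL) : HasDescent 1 κ μL μR := by
  refine ⟨fun x => if x = alternating 1 then 0 else toLex (1, 0), fun x hx => ?_⟩
  have key : ∀ y : Config 1, y ≠ x → y = alternating 1 := by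
    intro y hy
    funext i
    obtain rfl := Subsingleton.elim i 0
    have h1 : x 0 ≠ true := fun h => hx (by
      funext i
      obtain rfl := Subsingleton.elim i 0
      simpa [alternating] using h)
    have h2 : y 0 ≠ x 0 := fun h => hy (by
      funext i
      obtain rfl := Subsingleton.elim i 0
      exact h)
    cases h3 : x 0 <;> cases h4 : y 0 <;> simp_all [alternating]
  have hx0 : occ x 0 = 0 := by
    rcases occ_eq_zero_or_one x 0 with h | h
    · exact h
    · refine absurd ?_ hx
      funext i
      obtain rfl := Subsingleton.elim i 0
      cases h3 : x 0 <;> simp_all [alternating, occ]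
  refine ⟨flipConf x 0, ⟨flipConf_ne _ _, Or.inr (Or.inl rfl)⟩, ?_, fun z hz => ?_, ?_⟩
  · rw [phi_flip_first, hx0, rightTerm_last _ rfl]
    linarith
  · rw [key z hz.1, ← key _ (flipConf_ne x 0)]
  · beta_reduce
    rw [if_pos (key _ (flipConf_ne x 0)), if_neg hx]
    exact Prod.Lex.toLex_lt_toLex.2 (Or.inl one_pos)

lemma hasDescent {N : ℕ} [NeZero N] (hodd : Odd N) {κ μL μR : ℝ}
    (hμL : 0 < μL) (hμR : 0 < μR) (hmin : min μL μR < -κ) : HasDescent N κ μL μR := by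
  rcases Nat.lt_or_ge N 2 with hN | hN
  · have := Nat.pos_of_ne_zero (NeZero.ne N)
    obtain rfl : N = 1 := by omega
    exact hasDescent_one hμL
  · rcases min_lt_iff.1 hmin with h | h
    · exact (hasDescent_of_right_lt hN hμR hμL h).mirror hN hodd
    · exact hasDescent_of_right_lt hN hμL hμR h

lemma phi_le_neg_Gam {N : ℕ} [NeZero N] (κ μL μR : ℝ) {x y : Config N} (h : Allowed x y) :
    phi κ μL μR x y ≤ -Gam κ μL μR x := by
  rw [Gam, neg_neg]
  exact le_csSup (Set.toFinite _).bddAbove ⟨y, h, rfl⟩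

lemma Gam_eq_of_max {N : ℕ} [NeZero N] {κ μL μR : ℝ} {x y : Config N} (h : Allowed x y)
    (hmax : ∀ z, Allowed x z → phi κ μL μR x z ≤ phi κ μL μR x y) :
    Gam κ μL μR x = -phi κ μL μR x y := by
  refine le_antisymm (by linarith [phi_le_neg_Gam κ μL μR h]) (neg_le_neg ?_)
  refine csSup_le ⟨_, y, h, rfl⟩ ?_
  rintro _ ⟨z, hz, rfl⟩
  exact hmax z hz

lemma treeCost_nonneg {N : ℕ} [NeZero N] (κ μL μR : ℝ) {t : Config N → Config N} {x : Config N}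
    (h : IsInTree t x) : 0 ≤ treeCost κ μL μR t x := by
  refine Finset.sum_nonneg fun y _ => ?_
  split_ifs with hy
  · exact le_rfl
  · have := phi_le_neg_Gam κ μL μR (h.2.1 y hy)
    rw [Ucost]
    linarith

lemma Theta_nonneg {N : ℕ} [NeZero N] (κ μL μR : ℝ) (x : Config N) : 0 ≤ Theta κ μL μR x := by
  refine Real.sInf_nonneg ?_
  rintro _ ⟨t, ht, rfl⟩
  exact treeCost_nonneg κ μL μR ht

lemma HasDescent.Theta_alternating_nonpos {N : ℕ} [NeZero N] {κ μL μR : ℝ}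
    (h : HasDescent N κ μL μR) : Theta κ μL μR (alternating N) ≤ 0 := by
  obtain ⟨V, hV⟩ := h
  choose! f hf using hV
  set t : Config N → Config N := fun x => if x = alternating N then x else f x with ht
  have ht_ne : ∀ x, x ≠ alternating N → t x = f x := fun x hx => if_neg hx
  have hwf : WellFounded (fun x y : Config N => V x < V y) := by
    have : IsTrans (Config N) (fun x y => V x < V y) := ⟨fun _ _ _ => lt_trans⟩
    have : Std.Irrefl (fun x y : Config N => V x < V y) := ⟨fun _ => lt_irrefl _⟩
    exact Finite.wellFounded_of_trans_of_irrefl _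
  have htree : IsInTree t (alternating N) := by
    refine ⟨if_pos rfl, fun y hy => ht_ne y hy ▸ (hf y hy).1, fun y => ?_⟩
    induction y using hwf.induction with
    | _ y ih =>
      by_cases hy : y = alternating N
      · exact ⟨0, hy⟩
      · obtain ⟨n, hn⟩ := ih (t y) (ht_ne y hy ▸ (hf y hy).2.2.2)
        exact ⟨n + 1, hn⟩
  refine csInf_le ⟨0, ?_⟩ ⟨t, htree, ?_⟩
  · rintro _ ⟨s, hs, rfl⟩
    exact treeCost_nonneg κ μL μR hs
  · refine (Finset.sum_eq_zero fun y _ => ?_).symm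
    split_ifs with hy
    · rfl
    · obtain ⟨h1, -, h3, -⟩ := hf y hy
      rw [ht_ne y hy, Ucost, Gam_eq_of_max h1 h3, sub_self]

lemma occ_alternating {N : ℕ} (i : Fin N) :
    occ (alternating N) i = if (i : ℕ) % 2 = 0 then 1 else 0 := by
  simp [occ, alternating]

lemma leftTerm_alternating {N : ℕ} {i : Fin N} (hi : (i : ℕ) % 2 = 0) :
    leftTerm (fun _ => 1) (occ (alternating N)) i = 0 := by
  refine Finset.sum_eq_zero fun j _ => ?_
  split_ifs with h
  · rw [occ_alternating, if_neg (by omega), mul_zero]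
  · rfl

lemma rightTerm_alternating {N : ℕ} {i : Fin N} (hi : (i : ℕ) % 2 = 0) :
    rightTerm (occ (alternating N)) i = 0 := by
  refine Finset.sum_eq_zero fun j _ => ?_
  split_ifs with h
  · rw [occ_alternating, if_neg (by omega)]
  · rfl

lemma phi_alternating_neg {N : ℕ} [NeZero N] (hodd : Odd N) {κ μL μR : ℝ} (hκ : κ < 0)
    (hμL : 0 < μL) (hμR : 0 < μR) {y : Config N} (h : Allowed (alternating N) y) :
    phi κ μL μR (alternating N) y < 0 := by
  obtain ⟨m, hm⟩ := hodd
  have hlast : (lastIdx N : ℕ) % 2 = 0 := by have := lastIdx_add_one N; omega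
  have ho : ∀ i : Fin N, (i : ℕ) % 2 = 0 → occ (alternating N) i = 1 := fun i hi => by
    rw [occ_alternating, if_pos hi]
  have ho' : ∀ i : Fin N, (i : ℕ) % 2 = 1 → occ (alternating N) i = 0 := fun i hi => by
    rw [occ_alternating, if_neg (by omega)]
  obtain ⟨-, ⟨p, q, hpq, rfl⟩ | rfl | rfl⟩ := h
  · rw [phi_swapConf _ _ _ _ hpq, energy_swapConf _ _ hpq]
    rcases Nat.mod_two_eq_zero_or_one p with hp | hp
    · have hq := q.2
      rw [leftTerm_alternating hp, ho p hp, ho' q (by omega),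
        rightTerm_eq (j := ⟨q + 1, by omega⟩) _ rfl, ho _ (by simp; omega)]
      linarith
    · rw [rightTerm_alternating (by omega), ho' p hp, ho q (by omega),
        leftTerm_eq (i := ⟨p - 1, by omega⟩) _ _ (by simp; omega), ho _ (by simp; omega)]
      linarith
  · rw [phi_flip_first, ho 0 (by simp), rightTerm_alternating (by simp)]
    linarith
  · rcases Nat.lt_or_ge N 2 with hN | hN
    · have : lastIdx N = 0 := by
        ext
        have := lastIdx_add_one N
        simp
        omega
      rw [this, phi_flip_first, ho 0 (by simp), rightTerm_alternating (by simp)]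
      linarith
    · rw [phi_flip_last hN, ho _ hlast, leftTerm_alternating hlast]
      linarith

lemma Gam_alternating_pos {N : ℕ} [NeZero N] (hodd : Odd N) {κ μL μR : ℝ} (hκ : κ < 0)
    (hμL : 0 < μL) (hμR : 0 < μR) : 0 < Gam κ μL μR (alternating N) := by
  obtain ⟨y, hy, hmax⟩ := exists_max_phi κ μL μR (alternating N)
  rw [Gam_eq_of_max hy hmax]
  linarith [phi_alternating_neg hodd hκ hμL hμR hy]

end Kawasaki

open Kawasaki in
/-- for `N` odd, `κ < 0`, `μ_L > 0`, `μ_R > 0` and `min(μ_L,μ_R) < -κ`,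
the alternating configuration `(1,0,1,…,0,1)` is the unique dominant state:
it strictly maximizes `Ψ`. -/
theorem statement18 (N : ℕ) [NeZero N] (hNodd : Odd N) (κ μL μR : ℝ)
    (hκ : κ < 0) (hμL : 0 < μL) (hμR : 0 < μR) (hmin : min μL μR < -κ) :
    ∀ y : Config N, y ≠ ((fun i => decide ((i : ℕ) % 2 = 0)) : Config N) →
      Psi κ μL μR y < Psi κ μL μR ((fun i => decide ((i : ℕ) % 2 = 0)) : Config N) := by
  intro y hy
  have hd := hasDescent hNodd hμL hμR hmin
  have h1 := Gam_alternating_pos hNodd hκ hμL hμR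
  have h2 := hd.Theta_alternating_nonpos
  have h3 := Theta_nonneg κ μL μR y
  obtain ⟨V, hV⟩ := hd
  obtain ⟨z, hz, hz0, -, -⟩ := hV y hy
  have h4 := phi_le_neg_Gam κ μL μR hz
  change Psi κ μL μR y < Psi κ μL μR (alternating N)
  unfold Psi
  linarith
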